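/- arXiv:2412.20333 — 2 statements merged into one kernel-verified Lean document; each statement's English description precedes it below -/
import Mathlib

section
/- Let n ≥ 1 and p, q ∈ ℝⁿ. There exists a future-directed causal curve γ : [0,1] → ℝⁿ with γ(0) = p and γ(1) = q if and only if q₀ − p₀ ≥ ‖q⃗ − p⃗‖. -/
open Set Metric unitInterval

noncomputable section

/-- `n`-dimensional Minkowski space, modeled as `ℝⁿ` with the Euclidean norm. -/
abbrev Mink (n : ℕ) := EuclideanSpace ℝ (Fin n)

/-- The spatial part `x⃗ = (x 1, …, x (n-1)) ∈ ℝ^{n-1}` of `x ∈ ℝⁿ`. -/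
def spatial {n : ℕ} (x : Mink n) : Mink (n - 1) :=
  (WithLp.equiv 2 _).symm fun i : Fin (n - 1) => x ⟨i.1 + 1, by have := i.isLt; omega⟩

/-- A curve `γ` is future-directed causal if it is `C¹` and
`(γ₀)'(t) ≥ ‖(γ⃗)'(t)‖` for all `t ∈ [0,1]`. -/
def FDCausal {n : ℕ} [NeZero n] (γ : ℝ → Mink n) : Prop :=
  ContDiff ℝ 1 γ ∧
    ∀ t ∈ Set.Icc (0 : ℝ) 1,
      ‖deriv (fun s => spatial (γ s)) t‖ ≤ deriv (fun s => γ s 0) t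

/-- A curve `γ` is past-directed causal if it is `C¹` and
`-(γ₀)'(t) ≥ ‖(γ⃗)'(t)‖` for all `t ∈ [0,1]`. -/
def PDCausal {n : ℕ} [NeZero n] (γ : ℝ → Mink n) : Prop :=
  ContDiff ℝ 1 γ ∧
    ∀ t ∈ Set.Icc (0 : ℝ) 1,
      ‖deriv (fun s => spatial (γ s)) t‖ ≤ -(deriv (fun s => γ s 0) t)

/-- A causal curve is a future- or past-directed causal curve. -/
def IsCausalCurve {n : ℕ} [NeZero n] (γ : ℝ → Mink n) : Prop :=
  FDCausal γ ∨ PDCausal γ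

/-- `S` and `T` are causally disjoint if no causal curve starts in `S` and ends in `T`. -/
def CausallyDisjoint {n : ℕ} [NeZero n] (S T : Set (Mink n)) : Prop :=
  ¬ ∃ γ : ℝ → Mink n, IsCausalCurve γ ∧ γ 0 ∈ S ∧ γ 1 ∈ T

/-- The spatial part as a continuous linear map. -/
def spatialCLM (n : ℕ) : Mink n →L[ℝ] Mink (n - 1) :=
  LinearMap.toContinuousLinearMap
    { toFun := spatial
      map_add' := fun _ _ => rfl
      map_smul' := fun _ _ => rfl }

theorem HasDerivAt.spatial {n : ℕ} {γ : ℝ → Mink n} {v : Mink n} {t : ℝ}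
    (h : HasDerivAt γ v t) : HasDerivAt (fun s => spatial (γ s)) (spatial v) t :=
  (spatialCLM n).hasFDerivAt.comp_hasDerivAt t h

theorem HasDerivAt.time {n : ℕ} [NeZero n] {γ : ℝ → Mink n} {v : Mink n} {t : ℝ}
    (h : HasDerivAt γ v t) : HasDerivAt (fun s => γ s 0) (v 0) t :=
  (EuclideanSpace.proj (𝕜 := ℝ) (0 : Fin n)).hasFDerivAt.comp_hasDerivAt t h

/-- The endpoints of a future-directed causal curve are causally related. -/
theorem FDCausal.norm_spatial_sub_le {n : ℕ} [NeZero n] {γ : ℝ → Mink n} (h : FDCausal γ) :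
    ‖spatial (γ 1) - spatial (γ 0)‖ ≤ γ 1 0 - γ 0 0 := by
  have hd (t : ℝ) : HasDerivAt γ (deriv γ t) t :=
    (h.1.differentiable one_ne_zero t).hasDerivAt
  have hs (t : ℝ) := (hd t).spatial.sub_const (spatial (γ 0))
  have ht (t : ℝ) := (hd t).time.sub_const (γ 0 0)
  refine image_norm_le_of_norm_deriv_right_le_deriv_boundary
    (fun t _ => (hs t).continuousAt.continuousWithinAt) (fun t _ => (hs t).hasDerivWithinAt)
    (by simp) ht (fun t htI => ?_) (right_mem_Icc.2 zero_le_one)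
  simpa only [(hd t).spatial.deriv, (hd t).time.deriv] using h.2 t (Ico_subset_Icc_self htI)

/-- A segment whose direction lies in the closed future cone is future-directed causal. -/
theorem fdCausal_lineMap {n : ℕ} [NeZero n] {p q : Mink n}
    (h : ‖spatial q - spatial p‖ ≤ q 0 - p 0) :
    FDCausal (AffineMap.lineMap p q : ℝ → Mink n) := by
  refine ⟨?_, fun t _ => ?_⟩
  · simp only [AffineMap.coe_lineMap, vsub_eq_sub, vadd_eq_add]
    fun_prop
  · have hd : HasDerivAt (AffineMap.lineMap p q : ℝ → Mink n) (q - p) t :=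
      AffineMap.hasDerivAt_lineMap
    rw [hd.spatial.deriv, hd.time.deriv]
    exact h

/-- There is a future-directed causal curve from `p` to `q` iff `q₀ - p₀ ≥ ‖q⃗ - p⃗‖`. -/
theorem exists_fdCausal_iff (n : ℕ) [NeZero n] (hn : 1 ≤ n) (p q : Mink n) :
    (∃ γ : ℝ → Mink n, FDCausal γ ∧ γ 0 = p ∧ γ 1 = q) ↔
      ‖spatial q - spatial p‖ ≤ q 0 - p 0 := by
  constructor
  · rintro ⟨γ, hγ, rfl, rfl⟩
    exact hγ.norm_spatial_sub_le
  · intro h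
    exact ⟨_, fdCausal_lineMap h, AffineMap.lineMap_apply_zero p q,
      AffineMap.lineMap_apply_one p q⟩
end
end

section
/- Fix n ≥ 2 and k ≥ 1, and let A ⊆ CD_n(k) be the subspace of configurations all of whose centers lie in the {t = 0} hyperplane, i.e. (bᵢ)₀ = 0 for all i. Then A is a strong deformation retract of CD_n(k): there is a continuous map H : CD_n(k) × [0,1] → CD_n(k) with H(x,0) = x for all x, H(x,1) ∈ A for all x, and H(a,t) = a for all a ∈ A and t ∈ [0,1]. -/
open Set Metric unitInterval

noncomputable section

/-- The space `CD_n(k)` of `k` causally disjoint rectilinear discs in the unit disc,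
recorded as tuples of (radius, center). -/
def CDset (n : ℕ) [NeZero n] (k : ℕ) : Set (Fin k → ℝ × Mink n) :=
  {f | (∀ i, 0 < (f i).1 ∧ (f i).1 + ‖(f i).2‖ ≤ 1) ∧
    ∀ i j, i ≠ j →
      CausallyDisjoint (closedBall (f i).2 (f i).1) (closedBall (f j).2 (f j).1)}

/-- `spatial` as a continuous linear map. -/
def spatialL (n : ℕ) : Mink n →L[ℝ] Mink (n - 1) :=
  LinearMap.toContinuousLinearMap
    { toFun := spatial
      map_add' := fun _ _ => rfl
      map_smul' := fun _ _ => rfl }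

theorem spatial_add {n : ℕ} (x y : Mink n) : spatial (x + y) = spatial x + spatial y := rfl

theorem spatial_sub {n : ℕ} (x y : Mink n) : spatial (x - y) = spatial x - spatial y := rfl

theorem spatial_smul {n : ℕ} (c : ℝ) (x : Mink n) : spatial (c • x) = c • spatial x := rfl

theorem norm_sq_eq_time_add_spatial {n : ℕ} [NeZero n] (x : Mink n) :
    ‖x‖ ^ 2 = x 0 ^ 2 + ‖spatial x‖ ^ 2 := by
  obtain ⟨m, rfl⟩ : ∃ m, n = m + 1 := ⟨n - 1, by have := NeZero.pos n; omega⟩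
  rw [EuclideanSpace.norm_sq_eq, EuclideanSpace.norm_sq_eq, Fin.sum_univ_succ]
  simp only [Real.norm_eq_abs, sq_abs]
  rfl

/-- The unit vector in the time direction. -/
def timeUnit (n : ℕ) [NeZero n] : Mink n := EuclideanSpace.single 0 1

theorem timeUnit_zero (n : ℕ) [NeZero n] : timeUnit n 0 = 1 := by
  simp [timeUnit]

theorem spatial_timeUnit (n : ℕ) [NeZero n] : spatial (timeUnit n) = 0 := by
  ext i
  simp [spatial, timeUnit, Fin.ext_iff]

theorem abs_time_add_norm_spatial_le {n : ℕ} [NeZero n] (x : Mink n) :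
    |x 0| + ‖spatial x‖ ≤ √2 * ‖x‖ := by
  refine abs_le_of_sq_le_sq' ?_ (by positivity) |>.2
  rw [mul_pow, Real.sq_sqrt zero_le_two, norm_sq_eq_time_add_spatial x, ← sq_abs (x 0)]
  nlinarith [sq_nonneg (|x 0| - ‖spatial x‖)]

theorem norm_spatial_sub_le_of_fdCausal {n : ℕ} [NeZero n] {γ : ℝ → Mink n}
    (h : FDCausal γ) : ‖spatial (γ 1 - γ 0)‖ ≤ (γ 1 - γ 0) 0 := by
  obtain ⟨hγ, h⟩ := h
  have hd : Differentiable ℝ γ := hγ.differentiable one_ne_zero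
  have hs : Differentiable ℝ (fun s => spatial (γ s)) := (spatialL n).differentiable.comp hd
  have ht : Differentiable ℝ (fun s => γ s 0) :=
    (EuclideanSpace.proj (𝕜 := ℝ) (0 : Fin n)).differentiable.comp hd
  have key := image_norm_le_of_norm_deriv_right_le_deriv_boundary
    (f := fun s => spatial (γ s) - spatial (γ 0)) (B := fun s => γ s 0 - γ 0 0)
    (f' := deriv (fun s => spatial (γ s))) (B' := deriv (fun s => γ s 0)) (a := 0) (b := 1)
    (hs.continuous.sub continuous_const).continuousOn
    (fun x _ => ((hs x).hasDerivAt.sub_const _).hasDerivWithinAt) (by simp)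
    (fun x => (ht x).hasDerivAt.sub_const _)
    (fun x hx => h x ⟨hx.1, hx.2.le⟩)
  simpa [spatial_sub] using key (right_mem_Icc.2 zero_le_one)

theorem FDCausal.neg_of_pdCausal {n : ℕ} [NeZero n] {γ : ℝ → Mink n}
    (h : PDCausal γ) : FDCausal (fun s => -γ s) := by
  refine ⟨h.1.neg, fun t ht => ?_⟩
  have hs : (fun s => spatial (-γ s)) = fun s => -spatial (γ s) := rfl
  have h0 : (fun s => (-γ s) 0) = fun s => -(γ s 0) := rfl
  rw [hs, h0, deriv.fun_neg, deriv.fun_neg, norm_neg]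
  exact h.2 t ht

theorem causallyDisjoint_iff {n : ℕ} [NeZero n] (S T : Set (Mink n)) :
    CausallyDisjoint S T ↔ ∀ x ∈ S, ∀ y ∈ T, |(y - x) 0| < ‖spatial (y - x)‖ := by
  constructor
  · intro h x hx y hy
    by_contra! hc
    refine h ⟨fun s => x + s • (y - x), ?_, by simpa using hx, by simpa using hy⟩
    have hγ : ContDiff ℝ 1 (fun s : ℝ => x + s • (y - x)) := by fun_prop
    have hs (t : ℝ) : deriv (fun s : ℝ => spatial (x + s • (y - x))) t = spatial (y - x) := by
      have : HasDerivAt (fun s : ℝ => spatial x + s • spatial (y - x))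
          ((1 : ℝ) • spatial (y - x)) t :=
        ((hasDerivAt_id t).smul_const _).const_add _
      rw [one_smul] at this
      exact this.deriv
    have h0 (t : ℝ) : deriv (fun s : ℝ => (x + s • (y - x)) 0) t = (y - x) 0 := by
      have : HasDerivAt (fun s : ℝ => x 0 + s * (y - x) 0) (1 * (y - x) 0) t :=
        ((hasDerivAt_id t).mul_const _).const_add _
      rw [one_mul] at this
      exact this.deriv
    rcases le_abs.1 hc with hc | hc
    · exact Or.inl ⟨hγ, fun t _ => by rwa [hs, h0]⟩
    · exact Or.inr ⟨hγ, fun t _ => by rwa [hs, h0]⟩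
  · rintro h ⟨γ, hγ, hS, hT⟩
    refine (h _ hS _ hT).not_ge ?_
    rcases hγ with hγ | hγ
    · exact (norm_spatial_sub_le_of_fdCausal hγ).trans (le_abs_self _)
    · have hle := norm_spatial_sub_le_of_fdCausal (FDCausal.neg_of_pdCausal hγ)
      have e : -γ 1 - -γ 0 = (-1 : ℝ) • (γ 1 - γ 0) := by module
      rw [e, spatial_smul, norm_smul] at hle
      simp only [norm_neg, norm_one, one_mul, PiLp.smul_apply, smul_eq_mul, neg_mul] at hle
      exact hle.trans (neg_le_abs _)

/-- The vector of norm at most one along which `d` approaches the light cone fastest. -/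
theorem exists_toward_cone {n : ℕ} [NeZero n] (d : Mink n) :
    ∃ u : Mink n, ‖u‖ ≤ 1 ∧ ∀ R : ℝ, 0 ≤ R → ‖spatial d‖ - |d 0| ≤ √2 * R →
      ‖spatial (d + R • u)‖ ≤ |(d + R • u) 0| := by
  rcases eq_or_ne (spatial d) 0 with hd | hd
  · refine ⟨0, by simp, fun R _ _ => ?_⟩
    simp [hd]
  have hpos : 0 < ‖spatial d‖ := norm_pos_iff.2 hd
  obtain ⟨ε, hε, hεd⟩ : ∃ ε : ℝ, ε ^ 2 = 1 ∧ d 0 = ε * |d 0| := by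
    rcases le_total 0 (d 0) with h | h
    · exact ⟨1, by norm_num, by rw [abs_of_nonneg h, one_mul]⟩
    · exact ⟨-1, by norm_num, by rw [abs_of_nonpos h]; ring⟩
  have hε' : |ε| = 1 := by
    rw [← sq_eq_sq₀ (abs_nonneg _) zero_le_one, sq_abs, hε, one_pow]
  set c := ‖spatial d‖⁻¹
  have hcd : c * ‖spatial d‖ = 1 := inv_mul_cancel₀ hpos.ne'
  have h2 : √2 * √2 = 2 := Real.mul_self_sqrt zero_le_two
  set u : Mink n := (√2 / 2) • (-c • d + (ε + c * d 0) • timeUnit n) with hu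
  have hu0 : u 0 = √2 / 2 * ε := by
    simp only [hu, PiLp.add_apply, PiLp.smul_apply, smul_eq_mul, timeUnit_zero]
    ring
  have hus : spatial u = (-(√2 / 2) * c) • spatial d := by
    simp only [hu, spatial_smul, spatial_add, spatial_timeUnit, smul_zero, add_zero, smul_smul]
    congr 1
    ring
  refine ⟨u, ?_, fun R hR h => ?_⟩
  · rw [← sq_le_one_iff₀ (norm_nonneg _), norm_sq_eq_time_add_spatial, hu0, hus, norm_smul,
      Real.norm_eq_abs, mul_pow, mul_pow, sq_abs, hε]
    have : (-(√2 / 2) * c) ^ 2 * ‖spatial d‖ ^ 2 = 1 / 2 := by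
      calc _ = (√2 * √2) / 4 * (c * ‖spatial d‖) ^ 2 := by ring
        _ = _ := by rw [h2, hcd]; norm_num
    rw [this, div_pow, Real.sq_sqrt zero_le_two]
    norm_num
  · have e0 : (d + R • u) 0 = ε * (|d 0| + √2 / 2 * R) := by
      simp only [PiLp.add_apply, PiLp.smul_apply, smul_eq_mul, hu0]
      linear_combination hεd
    have es : spatial (d + R • u) = (1 - √2 / 2 * R * c) • spatial d := by
      rw [spatial_add, spatial_smul, hus]
      module
    have en : ‖spatial (d + R • u)‖ = |‖spatial d‖ - √2 / 2 * R| := by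
      rw [es, norm_smul, ← norm_norm (spatial d), ← norm_mul, Real.norm_eq_abs, norm_norm]
      congr 1
      linear_combination (-(√2 / 2 * R)) * hcd
    have hnn : 0 ≤ √2 / 2 * R := by positivity
    rw [en, e0, abs_mul, hε', one_mul, abs_of_nonneg (add_nonneg (abs_nonneg _) hnn), abs_le]
    constructor <;> linarith [abs_nonneg (d 0)]

theorem causallyDisjoint_closedBall_iff {n : ℕ} [NeZero n] {b b' : Mink n} {r r' : ℝ}
    (hr : 0 ≤ r) (hr' : 0 ≤ r') :
    CausallyDisjoint (closedBall b r) (closedBall b' r') ↔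
      √2 * (r + r') < ‖spatial (b' - b)‖ - |(b' - b) 0| := by
  rw [causallyDisjoint_iff]
  constructor
  · intro h
    by_contra! hc
    obtain ⟨u, hu, hcone⟩ := exists_toward_cone (b' - b)
    have hx : b - r • u ∈ closedBall b r := by
      rw [mem_closedBall, dist_eq_norm, sub_sub_cancel_left, norm_neg, norm_smul,
        Real.norm_of_nonneg hr]
      exact mul_le_of_le_one_right hr hu
    have hy : b' + r' • u ∈ closedBall b' r' := by
      rw [mem_closedBall, dist_eq_norm, add_sub_cancel_left, norm_smul,
        Real.norm_of_nonneg hr']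
      exact mul_le_of_le_one_right hr' hu
    refine (h _ hx _ hy).not_ge ?_
    have e : b' + r' • u - (b - r • u) = b' - b + (r + r') • u := by module
    rw [e]
    exact hcone _ (add_nonneg hr hr') hc
  · intro h x hx y hy
    rw [mem_closedBall, dist_eq_norm] at hx hy
    obtain ⟨e, he⟩ : ∃ e, e = (y - b') - (x - b) := ⟨_, rfl⟩
    have hyx : y - x = (b' - b) + e := by rw [he]; abel
    have hR : ‖e‖ ≤ r + r' := by
      rw [he]
      linarith [norm_sub_le (y - b') (x - b)]
    have h1 := abs_time_add_norm_spatial_le e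
    have h2 : √2 * ‖e‖ ≤ √2 * (r + r') := by gcongr
    have h3 : ‖spatial (b' - b)‖ - ‖spatial e‖ ≤ ‖spatial (y - x)‖ := by
      rw [hyx, spatial_add]
      exact norm_sub_le_norm_add _ _
    have h4 : |(y - x) 0| ≤ |(b' - b) 0| + |e 0| := by
      rw [hyx]
      exact abs_add_le _ _
    linarith

/-- Scale the time coordinate by `1 - s`, leaving the spatial part fixed. -/
def timeSquash {n : ℕ} [NeZero n] (s : ℝ) (x : Mink n) : Mink n :=
  x - (s * x 0) • timeUnit n

theorem timeSquash_zero {n : ℕ} [NeZero n] (s : ℝ) (x : Mink n) :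
    timeSquash s x 0 = (1 - s) * x 0 := by
  simp [timeSquash, timeUnit_zero]
  ring

theorem spatial_timeSquash {n : ℕ} [NeZero n] (s : ℝ) (x : Mink n) :
    spatial (timeSquash s x) = spatial x := by
  simp [timeSquash, spatial_sub, spatial_smul, spatial_timeUnit]

theorem timeSquash_sub {n : ℕ} [NeZero n] (s : ℝ) (x y : Mink n) :
    timeSquash s (x - y) = timeSquash s x - timeSquash s y := by
  simp only [timeSquash, PiLp.sub_apply]
  module

theorem abs_timeSquash_zero_le {n : ℕ} [NeZero n] {s : ℝ} (hs : s ∈ Icc (0 : ℝ) 1)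
    (x : Mink n) : |timeSquash s x 0| ≤ |x 0| := by
  rw [timeSquash_zero, abs_mul, abs_of_nonneg (sub_nonneg.2 hs.2)]
  exact mul_le_of_le_one_left (abs_nonneg _) (by linarith [hs.1])

theorem norm_timeSquash_le {n : ℕ} [NeZero n] {s : ℝ} (hs : s ∈ Icc (0 : ℝ) 1)
    (x : Mink n) : ‖timeSquash s x‖ ≤ ‖x‖ := by
  rw [← sq_le_sq₀ (norm_nonneg _) (norm_nonneg _), norm_sq_eq_time_add_spatial,
    norm_sq_eq_time_add_spatial x, spatial_timeSquash]
  gcongr ?_ + _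
  exact sq_le_sq.2 (abs_timeSquash_zero_le hs x)

theorem timeSquash_mem_CDset {n k : ℕ} [NeZero n] {s : ℝ} (hs : s ∈ Icc (0 : ℝ) 1)
    {f : Fin k → ℝ × Mink n} (hf : f ∈ CDset n k) :
    (fun i => ((f i).1, timeSquash s (f i).2)) ∈ CDset n k := by
  refine ⟨fun i => ⟨(hf.1 i).1, ?_⟩, fun i j hij => ?_⟩
  · linarith [norm_timeSquash_le hs (f i).2, (hf.1 i).2]
  · have h := hf.2 i j hij
    rw [causallyDisjoint_closedBall_iff (hf.1 i).1.le (hf.1 j).1.le] at h ⊢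
    rw [← timeSquash_sub, spatial_timeSquash]
    linarith [abs_timeSquash_zero_le hs ((f j).2 - (f i).2)]

/-- The subspace of `CD_n(k)` of configurations with all centers in the `{t = 0}`
hyperplane is a strong deformation retract of `CD_n(k)`. -/
theorem cd_deformation_retract (n k : ℕ) [NeZero n] (hn : 2 ≤ n) (hk : 1 ≤ k) :
    ∃ H : CDset n k × unitInterval → CDset n k,
      Continuous H ∧
      (∀ x, H (x, 0) = x) ∧
      (∀ x i, ((H (x, 1)).1 i).2 0 = 0) ∧
      (∀ (a : CDset n k) (t : unitInterval), (∀ i, (a.1 i).2 0 = 0) → H (a, t) = a) := by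
  refine ⟨fun p => ⟨fun i => ((p.1.1 i).1, timeSquash p.2 (p.1.1 i).2),
    timeSquash_mem_CDset p.2.2 p.1.2⟩, ?_, fun x => ?_, fun x i => ?_, fun a t ha => ?_⟩
  · refine Continuous.subtype_mk ?_ _
    refine continuous_pi fun i => ?_
    have hx : Continuous fun p : CDset n k × unitInterval => p.1.1 i :=
      (continuous_apply i).comp (continuous_subtype_val.comp continuous_fst)
    have ht : Continuous fun p : CDset n k × unitInterval => (p.1.1 i).2 0 :=
      (EuclideanSpace.proj (𝕜 := ℝ) (0 : Fin n)).continuous.comp hx.snd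
    have hs : Continuous fun p : CDset n k × unitInterval => (p.2 : ℝ) :=
      continuous_subtype_val.comp continuous_snd
    exact hx.fst.prodMk (hx.snd.sub ((hs.mul ht).smul continuous_const))
  · ext1
    funext i
    simp [timeSquash]
  · simp [timeSquash_zero]
  · ext1
    funext i
    simp [timeSquash, ha i]
end
end
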